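/- arXiv:1701.06084 — 3 statements merged into one kernel-verified Lean document; each statement's English description precedes it below -/
import Mathlib

section
/- For any two probability mass functions p1, p2 with full support on a finite alphabet Y, the pmf q*(y) = p1(y)^{1/2} p2(y)^{1/2} / Σ_{y'∈Y} p1(y')^{1/2} p2(y')^{1/2} satisfies D(q*‖p1) + D(q*‖p2) = 2·B(p1,p2), i.e., q* attains the minimum of q ↦ D(q‖p1) + D(q‖p2) over all pmfs q on Y. -/
open scoped BigOperators

/-- A probability mass function on a finite alphabet `Y`. -/
def IsPmf {Y : Type*} [Fintype Y] (p : Y → ℝ) : Prop :=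
  (∀ y, 0 ≤ p y) ∧ ∑ y, p y = 1

/-- KL divergence `D(p‖q)`, valued in the extended reals: it is `+∞` when the
support of `p` is not contained in that of `q`. -/
noncomputable def KL {Y : Type*} [Fintype Y] (p q : Y → ℝ) : EReal :=
  if ∀ y, q y = 0 → p y = 0 then ((∑ y, p y * Real.log (p y / q y) : ℝ) : EReal) else ⊤

/-- Bhattacharyya distance `B(p,q) = −log( Σ_y √(p y) √(q y) )`. -/
noncomputable def Bhat {Y : Type*} [Fintype Y] (p q : Y → ℝ) : ℝ :=
  - Real.log (∑ y, Real.sqrt (p y) * Real.sqrt (q y))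

/-- Pointwise form of Gibbs' inequality. -/
lemma sub_le_mul_log_div {a b : ℝ} (ha : 0 ≤ a) (hb : 0 < b) :
    a - b ≤ a * Real.log (a / b) := by
  rcases ha.eq_or_lt with rfl | ha
  · simp [hb.le]
  · have h := Real.one_sub_inv_le_log_of_pos (div_pos ha hb)
    calc a - b = a * (1 - (a / b)⁻¹) := by field_simp
      _ ≤ a * Real.log (a / b) := by gcongr

/-- Gibbs' inequality on a finite alphabet. -/
lemma IsPmf.sum_mul_log_div_nonneg {Y : Type*} [Fintype Y] {q r : Y → ℝ}
    (hq : IsPmf q) (hr : IsPmf r) (hrf : ∀ y, 0 < r y) :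
    0 ≤ ∑ y, q y * Real.log (q y / r y) := by
  calc (0 : ℝ) = ∑ y, (q y - r y) := by rw [Finset.sum_sub_distrib, hq.2, hr.2, sub_self]
    _ ≤ _ := Finset.sum_le_sum fun y _ => sub_le_mul_log_div (hq.1 y) (hrf y)

lemma KL_of_pos {Y : Type*} [Fintype Y] (q : Y → ℝ) {p : Y → ℝ} (hp : ∀ y, 0 < p y) :
    KL q p = ((∑ y, q y * Real.log (q y / p y) : ℝ) : EReal) :=
  if_pos fun y hy => absurd hy (hp y).ne'

lemma mul_log_div_add_mul_log_div {a b c z : ℝ} (hb : 0 < b) (hc : 0 < c) (hz : 0 < z) :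
    a * Real.log (a / b) + a * Real.log (a / c) =
      2 * (a * Real.log (a / (√b * √c / z))) + a * (2 * -Real.log z) := by
  rcases eq_or_ne a 0 with rfl | ha
  · simp
  · have hb' := Real.sqrt_pos.2 hb
    have hc' := Real.sqrt_pos.2 hc
    rw [Real.log_div ha hb.ne', Real.log_div ha hc.ne', Real.log_div ha (by positivity),
      Real.log_div (by positivity) hz.ne', Real.log_mul hb'.ne' hc'.ne',
      Real.log_sqrt hb.le, Real.log_sqrt hc.le]
    ring

/-- The sum of the two divergences from `q` is minimal up to twice the divergence from `q` to the
normalized geometric mean. -/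
lemma IsPmf.KL_add_KL {Y : Type*} [Fintype Y] {p1 p2 q : Y → ℝ} (hq : IsPmf q)
    (h1f : ∀ y, 0 < p1 y) (h2f : ∀ y, 0 < p2 y) (hz : 0 < ∑ y, √(p1 y) * √(p2 y)) :
    KL q p1 + KL q p2 =
      ((2 * ∑ y, q y * Real.log (q y / (√(p1 y) * √(p2 y) / ∑ y', √(p1 y') * √(p2 y'))) +
        2 * Bhat p1 p2 : ℝ) : EReal) := by
  rw [KL_of_pos q h1f, KL_of_pos q h2f, ← EReal.coe_add, ← Finset.sum_add_distrib,
    Finset.sum_congr rfl fun y _ => mul_log_div_add_mul_log_div (h1f y) (h2f y) hz,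
    Finset.sum_add_distrib, ← Finset.mul_sum, ← Finset.sum_mul, hq.2, one_mul, Bhat]

/-- The normalized geometric mean
`q*(y) = √(p1 y) √(p2 y) / Σ_{y'} √(p1 y') √(p2 y')` is a pmf satisfying
`D(q*‖p1) + D(q*‖p2) = 2 B(p1,p2)`, and it attains the minimum of
`q ↦ D(q‖p1) + D(q‖p2)` over all pmfs `q`. -/
theorem qstar_attains_min {Y : Type*} [Fintype Y] [Nonempty Y] (p1 p2 : Y → ℝ)
    (h1 : IsPmf p1) (h2 : IsPmf p2) (h1f : ∀ y, 0 < p1 y) (h2f : ∀ y, 0 < p2 y) :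
    ∀ qstar : Y → ℝ,
      qstar = (fun y => Real.sqrt (p1 y) * Real.sqrt (p2 y) /
        ∑ y', Real.sqrt (p1 y') * Real.sqrt (p2 y')) →
      IsPmf qstar ∧
      KL qstar p1 + KL qstar p2 = ((2 * Bhat p1 p2 : ℝ) : EReal) ∧
      ∀ q : Y → ℝ, IsPmf q → KL qstar p1 + KL qstar p2 ≤ KL q p1 + KL q p2 := by
  rintro qstar hqs
  have hpos : ∀ y, 0 < √(p1 y) * √(p2 y) := fun y =>
    mul_pos (Real.sqrt_pos.2 (h1f y)) (Real.sqrt_pos.2 (h2f y))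
  have hz : 0 < ∑ y, √(p1 y) * √(p2 y) :=
    Finset.sum_pos (fun y _ => hpos y) Finset.univ_nonempty
  have hqf : ∀ y, 0 < qstar y := fun y => by
    rw [hqs]
    exact div_pos (hpos y) hz
  have hq : IsPmf qstar := by
    refine ⟨fun y => (hqf y).le, ?_⟩
    rw [hqs, ← Finset.sum_div, div_self hz.ne']
  have key : ∀ q : Y → ℝ, IsPmf q → KL q p1 + KL q p2 =
      ((2 * ∑ y, q y * Real.log (q y / qstar y) + 2 * Bhat p1 p2 : ℝ) : EReal) := by
    intro q h
    rw [h.KL_add_KL h1f h2f hz, hqs]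
  have hval : KL qstar p1 + KL qstar p2 = ((2 * Bhat p1 p2 : ℝ) : EReal) := by
    rw [key qstar hq]
    simp [div_self (hqf _).ne']
  refine ⟨hq, hval, fun q h => ?_⟩
  rw [hval, key q h, EReal.coe_le_coe_iff]
  linarith [h.sum_mul_log_div_nonneg hq hqf]
end

section
/- (Positivity of the exponent α6) Let Y be a finite alphabet and let π and μ be distinct pmfs on Y with full support. Then the infimum, over triples of pmfs (q1, q2, q3) on Y satisfying D(q1‖q2) > D(q1‖q3), of D(q1‖μ) + D(q2‖μ) + D(q3‖π), is strictly positive. -/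
open scoped BigOperators

open Topology InformationTheory

/-- The KL divergence written as an `f`-divergence with `f = klFun`. -/
noncomputable def klSum {Y : Type*} [Fintype Y] (p q : Y → ℝ) : ℝ :=
  ∑ y, q y * klFun (p y / q y)

section

variable {Y : Type*} [Fintype Y] {p q : Y → ℝ}

theorem KL_eq_coe_klSum (hp : IsPmf p) (hq : IsPmf q) (hpos : ∀ y, 0 < q y) :
    KL p q = (klSum p q : EReal) := by
  have h : ∀ y, q y * klFun (p y / q y) = p y * Real.log (p y / q y) + (q y - p y) := by
    intro y
    have := (hpos y).ne'
    rw [klFun]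
    field_simp
    ring
  rw [KL, if_pos fun y hy => absurd hy (hpos y).ne', klSum, Finset.sum_congr rfl fun y _ => h y,
    Finset.sum_add_distrib, Finset.sum_sub_distrib, hp.2, hq.2, sub_self, add_zero]

theorem klSum_nonneg (hp : IsPmf p) (hq : IsPmf q) : 0 ≤ klSum p q :=
  Finset.sum_nonneg fun y _ =>
    mul_nonneg (hq.1 y) (klFun_nonneg (div_nonneg (hp.1 y) (hq.1 y)))

theorem eq_of_klSum_eq_zero (hp : IsPmf p) (hpos : ∀ y, 0 < q y) (h : klSum p q = 0) :
    p = q := by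
  have hdiv : ∀ y, 0 ≤ p y / q y := fun y => div_nonneg (hp.1 y) (hpos y).le
  rw [klSum, Finset.sum_eq_zero_iff_of_nonneg fun y _ =>
    mul_nonneg (hpos y).le (klFun_nonneg (hdiv y))] at h
  funext y
  have hy := (mul_eq_zero.1 (h y (Finset.mem_univ y))).resolve_left (hpos y).ne'
  rwa [klFun_eq_zero_iff (hdiv y), div_eq_one_iff_eq (hpos y).ne'] at hy

theorem klSum_self (hpos : ∀ y, 0 < q y) : klSum q q = 0 :=
  Finset.sum_eq_zero fun y _ => by rw [div_self (hpos y).ne', klFun_one, mul_zero]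

theorem continuous_klSum_left (q : Y → ℝ) : Continuous fun p => klSum p q := by
  unfold klSum
  fun_prop

theorem continuousAt_klSum (hpos : ∀ y, 0 < q y) :
    ContinuousAt (fun x : (Y → ℝ) × (Y → ℝ) => klSum x.1 x.2) (p, q) := by
  unfold klSum
  refine tendsto_finsetSum _ fun y _ => ?_
  have h₁ : ContinuousAt (fun x : (Y → ℝ) × (Y → ℝ) => x.1 y) (p, q) := by fun_prop
  have h₂ : ContinuousAt (fun x : (Y → ℝ) × (Y → ℝ) => x.2 y) (p, q) := by fun_prop
  exact h₂.mul (continuous_klFun.continuousAt.comp (h₁.div h₂ (hpos y).ne'))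

theorem eventually_forall_pos (hpos : ∀ y, 0 < q y) : ∀ᶠ r in 𝓝 q, ∀ y, 0 < r y :=
  Filter.eventually_all.2 fun y => (continuous_apply y).continuousAt.eventually_const_lt (hpos y)

theorem isCompact_setOf_isPmf : IsCompact {p : Y → ℝ | IsPmf p} :=
  isCompact_stdSimplex ℝ Y

/-- Near `(μ, μ, π)` the divergence to the second entry is below that to the third. -/
theorem eventually_klSum_lt {π μ : Y → ℝ} (hπ : IsPmf π) (hμ : IsPmf μ)
    (hπf : ∀ y, 0 < π y) (hμf : ∀ y, 0 < μ y) (hne : π ≠ μ) :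
    ∀ᶠ t : (Y → ℝ) × (Y → ℝ) × (Y → ℝ) in 𝓝 (μ, μ, π),
      (∀ y, 0 < t.2.1 y) ∧ (∀ y, 0 < t.2.2 y) ∧ klSum t.1 t.2.1 < klSum t.1 t.2.2 := by
  have hlt : klSum μ μ < klSum μ π := by
    rw [klSum_self hμf]
    exact (klSum_nonneg hμ hπ).lt_of_ne fun h => hne (eq_of_klSum_eq_zero hμ hπf h.symm).symm
  have c₁ : ContinuousAt (fun t : (Y → ℝ) × (Y → ℝ) × (Y → ℝ) => (t.1, t.2.1)) (μ, μ, π) := by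
    fun_prop
  have c₂ : ContinuousAt (fun t : (Y → ℝ) × (Y → ℝ) × (Y → ℝ) => (t.1, t.2.2)) (μ, μ, π) := by
    fun_prop
  have d₁ := ContinuousAt.comp (f := fun t : (Y → ℝ) × (Y → ℝ) × (Y → ℝ) => (t.1, t.2.1))
    (x := (μ, μ, π)) (continuousAt_klSum (p := μ) hμf) c₁
  have d₂ := ContinuousAt.comp (f := fun t : (Y → ℝ) × (Y → ℝ) × (Y → ℝ) => (t.1, t.2.2))
    (x := (μ, μ, π)) (continuousAt_klSum (p := μ) hπf) c₂
  exact (c₁.snd.eventually (eventually_forall_pos hμf)).and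
    ((c₂.snd.eventually (eventually_forall_pos hπf)).and (d₁.eventually_lt d₂ hlt))

end

/-- positivity of the exponent α6. For distinct full-support
pmfs `π` and `μ`, the infimum over pmf triples `(q1,q2,q3)` satisfying
`D(q1‖q2) > D(q1‖q3)` of `D(q1‖μ) + D(q2‖μ) + D(q3‖π)` is strictly positive. -/
theorem alpha6_pos {Y : Type*} [Fintype Y] [Nonempty Y]
    (π μ : Y → ℝ) (hπ : IsPmf π) (hμ : IsPmf μ)
    (hπf : ∀ y, 0 < π y) (hμf : ∀ y, 0 < μ y) (hne : π ≠ μ) :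
    0 < sInf {r : EReal | ∃ q1 q2 q3 : Y → ℝ,
      IsPmf q1 ∧ IsPmf q2 ∧ IsPmf q3 ∧
      KL q1 q3 < KL q1 q2 ∧
      r = KL q1 μ + KL q2 μ + KL q3 π} := by
  obtain ⟨U, hU, hUo, hmem⟩ := eventually_nhds_iff.1 (eventually_klSum_lt hπ hμ hπf hμf hne)
  let S : Set (Y → ℝ) := {p | IsPmf p}
  have hK : IsCompact ((S ×ˢ S ×ˢ S) \ U) :=
    (isCompact_setOf_isPmf.prod (isCompact_setOf_isPmf.prod isCompact_setOf_isPmf)).diff hUo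
  have hF : Continuous fun t : (Y → ℝ) × (Y → ℝ) × (Y → ℝ) =>
      klSum t.1 μ + klSum t.2.1 μ + klSum t.2.2 π :=
    (((continuous_klSum_left μ).comp continuous_fst).add
      ((continuous_klSum_left μ).comp (continuous_fst.comp continuous_snd))).add
      ((continuous_klSum_left π).comp (continuous_snd.comp continuous_snd))
  obtain ⟨c, hc, hle⟩ := hK.exists_forall_le' hF.continuousOn (a := 0) (by
    rintro ⟨q1, q2, q3⟩ ⟨⟨h1, h2, h3⟩, hnot⟩
    have n1 : 0 ≤ klSum q1 μ := klSum_nonneg h1 hμ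
    have n2 : 0 ≤ klSum q2 μ := klSum_nonneg h2 hμ
    have n3 : 0 ≤ klSum q3 π := klSum_nonneg h3 hπ
    by_contra! hle
    dsimp only at hle
    have e1 : q1 = μ := eq_of_klSum_eq_zero h1 hμf (by linarith)
    have e2 : q2 = μ := eq_of_klSum_eq_zero h2 hμf (by linarith)
    have e3 : q3 = π := eq_of_klSum_eq_zero h3 hπf (by linarith)
    exact hnot (by rwa [e1, e2, e3]))
  refine lt_of_lt_of_le (EReal.coe_pos.2 hc) (le_sInf ?_)
  rintro r ⟨q1, q2, q3, h1, h2, h3, hlt, rfl⟩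
  rw [KL_eq_coe_klSum h1 hμ hμf, KL_eq_coe_klSum h2 hμ hμf, KL_eq_coe_klSum h3 hπ hπf]
  norm_cast
  refine hle (q1, q2, q3) ⟨⟨h1, h2, h3⟩, fun hin => ?_⟩
  obtain ⟨p2, p3, hlt'⟩ := hU _ hin
  rw [KL_eq_coe_klSum h1 h3 p3, KL_eq_coe_klSum h1 h2 p2, EReal.coe_lt_coe_iff] at hlt
  exact hlt.not_gt hlt'
end

section
/- (Positivity of the exponent α10 under the clustering condition) Let Y be a finite alphabet, let S and T be nonempty finite index sets, and let μ_i (i ∈ S) and π_j (j ∈ T) be pmfs on Y with full support satisfying the clustering condition: max_{i,i'∈S} D(μ_i‖μ_{i'}) < min_{i∈S, j∈T} min{ D(μ_i‖π_j), D(π_j‖μ_i) } and max_{j,j'∈T} D(π_j‖π_{j'}) < min_{i∈S, j∈T} min{ D(μ_i‖π_j), D(π_j‖μ_i) }. Then the infimum, over i1, i2 ∈ S, j ∈ T, and triples of pmfs (q1, q2, q3) on Y satisfying D(q1‖q2) > D(q1‖q3), of D(q1‖μ_{i1}) + D(q2‖μ_{i2}) + D(q3‖π_j), is strictly positive. -/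
open scoped BigOperators

open Filter Topology

lemma sub_add_sq_div_four_le_mul_log {x y : ℝ} (hx : 0 ≤ x) (hy : 0 ≤ y) (hx1 : x ≤ 1)
    (hy1 : y ≤ 1) (hxy : y = 0 → x = 0) :
    x - y + (x - y) ^ 2 / 4 ≤ x * Real.log (x / y) := by
  rcases hx.eq_or_lt with rfl | hx
  · simp only [zero_mul]
    nlinarith
  have hy : 0 < y := hy.lt_of_ne fun h => hx.ne' (hxy h.symm)
  obtain ⟨s, hs, rfl⟩ : ∃ s, 0 < s ∧ x = s ^ 2 :=
    ⟨√x, Real.sqrt_pos.2 hx, (Real.sq_sqrt hx.le).symm⟩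
  obtain ⟨t, ht, rfl⟩ : ∃ t, 0 < t ∧ y = t ^ 2 :=
    ⟨√y, Real.sqrt_pos.2 hy, (Real.sq_sqrt hy.le).symm⟩
  have hs1 : s ≤ 1 := by nlinarith
  have ht1 : t ≤ 1 := by nlinarith
  have hlog : 1 - t / s ≤ Real.log (s / t) := by
    have := Real.one_sub_inv_le_log_of_pos (div_pos hs ht)
    rwa [inv_div] at this
  have hmul : 2 * (s ^ 2 - s * t) ≤ s ^ 2 * Real.log (s ^ 2 / t ^ 2) := by
    rw [← div_pow, Real.log_pow]
    have h := mul_le_mul_of_nonneg_left hlog (by positivity : 0 ≤ 2 * s ^ 2)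
    have e : 2 * s ^ 2 * (1 - t / s) = 2 * (s ^ 2 - s * t) := by field_simp
    rw [e] at h
    push_cast
    linarith
  have hsq : (s ^ 2 - t ^ 2) ^ 2 / 4 ≤ (s - t) ^ 2 := by
    have h4 : (s + t) ^ 2 ≤ 4 := by nlinarith
    have := mul_le_mul_of_nonneg_left h4 (sq_nonneg (s - t))
    nlinarith
  nlinarith

lemma IsPmf.le_one {Y : Type*} [Fintype Y] {p : Y → ℝ} (hp : IsPmf p) (y : Y) : p y ≤ 1 :=
  hp.2 ▸ Finset.single_le_sum (fun z _ => hp.1 z) (Finset.mem_univ y)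

/-- A Pinsker-type inequality for the sup distance. -/
lemma dist_sq_div_four_le_KL {Y : Type*} [Fintype Y] [Nonempty Y] {p q : Y → ℝ}
    (hp : IsPmf p) (hq : IsPmf q) : ((dist p q ^ 2 / 4 : ℝ) : EReal) ≤ KL p q := by
  unfold KL
  split_ifs with h
  · rw [EReal.coe_le_coe_iff]
    have hsum : ∑ y, (p y - q y) ^ 2 / 4 ≤ ∑ y, p y * Real.log (p y / q y) := by
      have := Finset.sum_le_sum fun y (_ : y ∈ Finset.univ) =>
        sub_add_sq_div_four_le_mul_log (hp.1 y) (hq.1 y) (hp.le_one y) (hq.le_one y) (h y)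
      simpa only [Finset.sum_add_distrib, Finset.sum_sub_distrib, hp.2, hq.2, sub_self,
        zero_add] using this
    have hy (y : Y) : (p y - q y) ^ 2 / 4 ≤ ∑ y, p y * Real.log (p y / q y) :=
      (Finset.single_le_sum (f := fun y => (p y - q y) ^ 2 / 4) (fun z _ => by positivity)
        (Finset.mem_univ y)).trans hsum
    have hd : dist p q ≤ √(4 * ∑ y, p y * Real.log (p y / q y)) := by
      rw [dist_pi_le_iff (Real.sqrt_nonneg _)]
      intro y
      rw [Real.dist_eq]
      exact Real.abs_le_sqrt (by linarith [hy y])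
    obtain ⟨y⟩ := ‹Nonempty Y›
    have h0 : 0 ≤ ∑ y, p y * Real.log (p y / q y) := (by positivity : _ ≤ _).trans (hy y)
    have := pow_le_pow_left₀ dist_nonneg hd 2
    rw [Real.sq_sqrt (by linarith)] at this
    linarith
  · exact le_top

lemma KL_eq_sum_of_pos {Y : Type*} [Fintype Y] {p q : Y → ℝ} (hq : ∀ y, 0 < q y) :
    KL p q = ((∑ y, p y * Real.log (p y / q y) : ℝ) : EReal) :=
  if_pos fun y h => absurd h (hq y).ne'

lemma eventually_KL_lt_KL {Y : Type*} [Fintype Y] {a b c : Y → ℝ} (ha : ∀ y, 0 < a y)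
    (hb : ∀ y, 0 < b y) (hc : ∀ y, 0 < c y) (h : KL a b < KL a c) :
    ∀ᶠ q : (Y → ℝ) × (Y → ℝ) × (Y → ℝ) in 𝓝 (a, b, c), KL q.1 q.2.1 < KL q.1 q.2.2 := by
  rw [KL_eq_sum_of_pos hb, KL_eq_sum_of_pos hc, EReal.coe_lt_coe_iff] at h
  have hpos2 : ∀ᶠ q : (Y → ℝ) × (Y → ℝ) × (Y → ℝ) in 𝓝 (a, b, c), ∀ y, 0 < q.2.1 y :=
    eventually_all.2 fun y =>
      (by fun_prop : ContinuousAt (fun q : (Y → ℝ) × (Y → ℝ) × (Y → ℝ) => q.2.1 y)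
        (a, b, c)).eventually (lt_mem_nhds (hb y))
  have hpos3 : ∀ᶠ q : (Y → ℝ) × (Y → ℝ) × (Y → ℝ) in 𝓝 (a, b, c), ∀ y, 0 < q.2.2 y :=
    eventually_all.2 fun y =>
      (by fun_prop : ContinuousAt (fun q : (Y → ℝ) × (Y → ℝ) × (Y → ℝ) => q.2.2 y)
        (a, b, c)).eventually (lt_mem_nhds (hc y))
  have hcont2 : ContinuousAt (fun q : (Y → ℝ) × (Y → ℝ) × (Y → ℝ) =>
      ∑ y, q.1 y * Real.log (q.1 y / q.2.1 y)) (a, b, c) := by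
    refine tendsto_finsetSum _ fun y _ => ContinuousAt.mul (by fun_prop) (ContinuousAt.log
      (ContinuousAt.div (by fun_prop) (by fun_prop) (hb y).ne') (div_pos (ha y) (hb y)).ne')
  have hcont3 : ContinuousAt (fun q : (Y → ℝ) × (Y → ℝ) × (Y → ℝ) =>
      ∑ y, q.1 y * Real.log (q.1 y / q.2.2 y)) (a, b, c) := by
    refine tendsto_finsetSum _ fun y _ => ContinuousAt.mul (by fun_prop) (ContinuousAt.log
      (ContinuousAt.div (by fun_prop) (by fun_prop) (hc y).ne') (div_pos (ha y) (hc y)).ne')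
  filter_upwards [hpos2, hpos3, hcont2.eventually_lt hcont3 h] with q h2 h3 hlt
  rwa [KL_eq_sum_of_pos h2, KL_eq_sum_of_pos h3, EReal.coe_lt_coe_iff]

lemma exists_pos_le_KL_add_KL_add_KL {Y : Type*} [Fintype Y] [Nonempty Y] {a b c : Y → ℝ}
    (ha : IsPmf a) (hb : IsPmf b) (hc : IsPmf c) (ha0 : ∀ y, 0 < a y)
    (hb0 : ∀ y, 0 < b y) (hc0 : ∀ y, 0 < c y) (h : KL a b < KL a c) :
    ∃ ε : ℝ, 0 < ε ∧ ∀ q1 q2 q3 : Y → ℝ, IsPmf q1 → IsPmf q2 → IsPmf q3 →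
      KL q1 q3 < KL q1 q2 → (ε : EReal) ≤ KL q1 a + KL q2 b + KL q3 c := by
  obtain ⟨δ, hδ, hball⟩ := Metric.eventually_nhds_iff.1 (eventually_KL_lt_KL ha0 hb0 hc0 h)
  refine ⟨δ ^ 2 / 4, by positivity, fun q1 q2 q3 h1 h2 h3 hlt => ?_⟩
  have hsum : ((dist q1 a ^ 2 / 4 + dist q2 b ^ 2 / 4 + dist q3 c ^ 2 / 4 : ℝ) : EReal) ≤
      KL q1 a + KL q2 b + KL q3 c := by
    push_cast [EReal.coe_add]
    exact add_le_add (add_le_add (by exact_mod_cast dist_sq_div_four_le_KL h1 ha)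
      (by exact_mod_cast dist_sq_div_four_le_KL h2 hb))
      (by exact_mod_cast dist_sq_div_four_le_KL h3 hc)
  refine le_trans (EReal.coe_le_coe_iff.2 ?_) hsum
  have hδle : δ ≤ dist (q1, q2, q3) (a, b, c) :=
    not_lt.1 fun hd => lt_asymm hlt (hball hd)
  simp only [Prod.dist_eq, le_max_iff] at hδle
  rcases hδle with hd | hd | hd <;>
  · have := pow_le_pow_left₀ hδ.le hd 2
    linarith [sq_nonneg (dist q1 a), sq_nonneg (dist q2 b), sq_nonneg (dist q3 c)]

/-- positivity of the exponent α10 under the clustering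
condition. The clustering condition states that the KL divergence between any
two distributions within the same cluster (outlying cluster `{μ i}_{i∈S}` or
typical cluster `{π j}_{j∈T}`) is strictly less than the KL divergence, in
either direction, between any two distributions in different clusters. Under it,
the stated infimum is strictly positive. -/
theorem alpha10_pos {Y : Type*} [Fintype Y] [Nonempty Y] {ι κ : Type*}
    (S : Finset ι) (hS : S.Nonempty) (T : Finset κ) (hT : T.Nonempty)
    (μ : ι → Y → ℝ) (π : κ → Y → ℝ)
    (hμ : ∀ i ∈ S, IsPmf (μ i)) (hμf : ∀ i ∈ S, ∀ y, 0 < μ i y)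
    (hπ : ∀ j ∈ T, IsPmf (π j)) (hπf : ∀ j ∈ T, ∀ y, 0 < π j y)
    (hclusterμ : ∀ i ∈ S, ∀ i' ∈ S, ∀ i'' ∈ S, ∀ j ∈ T,
      KL (μ i) (μ i') < KL (μ i'') (π j) ∧ KL (μ i) (μ i') < KL (π j) (μ i''))
    (hclusterπ : ∀ j ∈ T, ∀ j' ∈ T, ∀ i ∈ S, ∀ j'' ∈ T,
      KL (π j) (π j') < KL (μ i) (π j'') ∧ KL (π j) (π j') < KL (π j'') (μ i)) :
    0 < sInf {r : EReal | ∃ i1 ∈ S, ∃ i2 ∈ S, ∃ j ∈ T, ∃ q1 q2 q3 : Y → ℝ,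
      IsPmf q1 ∧ IsPmf q2 ∧ IsPmf q3 ∧
      KL q1 q3 < KL q1 q2 ∧
      r = KL q1 (μ i1) + KL q2 (μ i2) + KL q3 (π j)} := by
  have hev : ∀ᶠ ε : ℝ in 𝓝[>] 0, ∀ i1 ∈ S, ∀ i2 ∈ S, ∀ j ∈ T, ∀ q1 q2 q3 : Y → ℝ,
      IsPmf q1 → IsPmf q2 → IsPmf q3 → KL q1 q3 < KL q1 q2 →
      (ε : EReal) ≤ KL q1 (μ i1) + KL q2 (μ i2) + KL q3 (π j) := by
    simp only [← Finset.mem_coe]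
    refine (eventually_all_finite S.finite_toSet).2 fun i1 h1 =>
      (eventually_all_finite S.finite_toSet).2 fun i2 h2 =>
      (eventually_all_finite T.finite_toSet).2 fun j hj => ?_
    obtain ⟨ε, hε, hle⟩ := exists_pos_le_KL_add_KL_add_KL (hμ i1 h1) (hμ i2 h2) (hπ j hj)
      (hμf i1 h1) (hμf i2 h2) (hπf j hj) (hclusterμ i1 h1 i2 h2 i1 h1 j hj).1
    filter_upwards [Ioc_mem_nhdsGT hε] with ε' hε' q1 q2 q3 hq1 hq2 hq3 hlt
    exact (EReal.coe_le_coe_iff.2 hε'.2).trans (hle q1 q2 q3 hq1 hq2 hq3 hlt)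
  obtain ⟨ε, hle, hε⟩ := (hev.and self_mem_nhdsWithin).exists
  refine (EReal.coe_pos.2 hε).trans_le (le_sInf ?_)
  rintro r ⟨i1, h1, i2, h2, j, hj, q1, q2, q3, hq1, hq2, hq3, hlt, rfl⟩
  exact hle i1 h1 i2 h2 j hj q1 q2 q3 hq1 hq2 hq3 hlt
end
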